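/- Let A₁, …, Aₙ be positive invertible operators on H with mI ≤ Aⱼ ≤ MI (j = 1, …, n) for some scalars 0 < m < M, let h = M/m, and let F satisfy the arithmetic–harmonic sandwich for the probability vector ω. Then for all real p, q with 0 < q < 1 and q < p, K(h^q, 1/q)⁻¹·K(hᵖ, −q/p)^{−1/q}·F(A₁ᵖ, …, Aₙᵖ)^{1/p} ≤ F(A₁^q, …, Aₙ^q)^{1/q} ≤ K(h^q, 1/q)·K(hᵖ, −q/p)^{1/q}·F(A₁ᵖ, …, Aₙᵖ)^{1/p}. -/

import Mathlib

noncomputable section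

/-- The arithmetic–harmonic sandwich for the probability vector `ω`:
`(∑ ωⱼ Bⱼ⁻¹)⁻¹ ≤ F (B₁, …, Bₙ) ≤ ∑ ωⱼ Bⱼ` for all positive invertible `B₁, …, Bₙ`,
and `F` takes values in the positive invertible operators. -/
def IsAHSandwich {E : Type*} [NormedAddCommGroup E] [InnerProductSpace ℂ E]
    [CompleteSpace E] {n : ℕ} (ω : Fin n → ℝ)
    (F : (Fin n → (E →L[ℂ] E)) → (E →L[ℂ] E)) : Prop :=
  ∀ B : Fin n → (E →L[ℂ] E), (∀ j, 0 ≤ B j) → (∀ j, IsUnit (B j)) →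
    (0 ≤ F B ∧ IsUnit (F B)) ∧
    Ring.inverse (∑ j, ω j • Ring.inverse (B j)) ≤ F B ∧
    F B ≤ ∑ j, ω j • B j

/-- The generalized Kantorovich constant `K(h, p)`, with `K(h, 0) = K(h, 1) = 1`. -/
def Kconst (h p : ℝ) : ℝ :=
  if p = 0 ∨ p = 1 then 1
  else ((h ^ p - h) / ((p - 1) * (h - 1))) *
    (((p - 1) / p) * ((h ^ p - 1) / (h ^ p - h))) ^ p

theorem one_add_mul_sub_le_rpow {s p : ℝ} (hs : 0 < s) (hp : 1 < p ∨ p < 0) :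
    1 + p * (s - 1) ≤ s ^ p := by
  rcases hp with hp | hp
  · simpa using one_add_mul_self_le_rpow_one_add (s := s - 1) (by linarith) hp.le
  · have h1 := Real.add_one_le_exp (Real.log s * p)
    rw [← Real.rpow_def_of_pos hs] at h1
    nlinarith [Real.log_le_sub_one_of_pos hs]

theorem rpow_tangent_le {s t p : ℝ} (hs : 0 < s) (ht : 0 < t) (hp : 1 < p ∨ p < 0) :
    t ^ p * (1 + p * (s / t - 1)) ≤ s ^ p := by
  have h1 := one_add_mul_sub_le_rpow (div_pos hs ht) hp
  rw [Real.div_rpow hs.le ht.le, le_div_iff₀ (Real.rpow_pos_of_pos ht p)] at h1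
  linarith

theorem rpow_le_chord {h t p : ℝ} (hh : 1 < h) (h1 : 1 ≤ t) (h2 : t ≤ h)
    (hp : 1 < p ∨ p < 0) : t ^ p * (h - 1) ≤ (h - t) + h ^ p * (t - 1) := by
  have ht : 0 < t := by linarith
  have e1 := rpow_tangent_le one_pos ht hp
  have e2 := rpow_tangent_le (by linarith : 0 < h) ht hp
  rw [Real.one_rpow] at e1
  have e3 := mul_le_mul_of_nonneg_right e1 (sub_nonneg.2 h2)
  have e4 := mul_le_mul_of_nonneg_right e2 (sub_nonneg.2 h1)
  have e5 : t ^ p * (1 + p * (1 / t - 1)) * (h - t) + t ^ p * (1 + p * (h / t - 1)) * (t - 1) =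
      t ^ p * (h - 1) := by
    field_simp
    ring
  linarith

theorem div_rpow_sub_pos {h p : ℝ} (hh : 1 < h) (hp : 1 < p ∨ p < 0) :
    0 < (h ^ p - h) / (p - 1) ∧ 0 < (h ^ p - 1) / p := by
  rcases hp with hp | hp
  · have h1 : h < h ^ p := by
      simpa using Real.rpow_lt_rpow_of_exponent_lt hh hp
    exact ⟨div_pos (by linarith) (by linarith), div_pos (by linarith) (by linarith)⟩
  · have h1 : h ^ p < 1 := Real.rpow_lt_one_of_one_lt_of_neg hh hp
    exact ⟨div_pos_of_neg_of_neg (by linarith) (by linarith),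
      div_pos_of_neg_of_neg (by linarith) hp⟩

theorem Kconst_eq {h p : ℝ} (hp : 1 < p ∨ p < 0) :
    Kconst h p = (h ^ p - h) / (p - 1) / (h - 1) *
      (((h ^ p - 1) / p) / ((h ^ p - h) / (p - 1))) ^ p := by
  have h0 : ¬ (p = 0 ∨ p = 1) := by
    rintro (rfl | rfl) <;> norm_num at hp
  rw [Kconst, if_neg h0, div_div]
  congr 2
  rw [div_div_div_eq, div_mul_div_comm, mul_comm (p - 1)]

theorem Kconst_pos {h p : ℝ} (hh : 1 < h) (hp : 1 < p ∨ p < 0) : 0 < Kconst h p := by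
  obtain ⟨hD, hc⟩ := div_rpow_sub_pos hh hp
  rw [Kconst_eq hp]
  exact mul_pos (div_pos hD (by linarith)) (Real.rpow_pos_of_pos (div_pos hc hD) p)

theorem chord_le_Kconst_mul_rpow {h t p : ℝ} (hh : 1 < h) (ht : 0 < t) (hp : 1 < p ∨ p < 0) :
    (h - t) + h ^ p * (t - 1) ≤ Kconst h p * t ^ p * (h - 1) := by
  obtain ⟨hD, hc⟩ := div_rpow_sub_pos hh hp
  have hp0 : p ≠ 0 := by rintro rfl; norm_num at hp
  have hp1 : p - 1 ≠ 0 := by intro h; rcases hp with hp | hp <;> linarith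
  have hh1 : h - 1 ≠ 0 := by linarith
  rw [Kconst_eq hp]
  set D := (h ^ p - h) / (p - 1) with hDdef
  set c := (h ^ p - 1) / p with hcdef
  have eD : D * (p - 1) = h ^ p - h := div_mul_cancel₀ _ hp1
  have ec : c * p = h ^ p - 1 := div_mul_cancel₀ _ hp0
  have h1 := mul_le_mul_of_nonneg_left
    (one_add_mul_sub_le_rpow (mul_pos (div_pos hc hD) ht) hp) hD.le
  rw [Real.mul_rpow (div_pos hc hD).le ht.le] at h1
  have e1 : D * (1 + p * (c / D * t - 1)) = D + c * p * t - D * p := by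
    field_simp
    ring
  have e2 : D / (h - 1) * (c / D) ^ p * t ^ p * (h - 1) = D * ((c / D) ^ p * t ^ p) := by
    field_simp
  rw [e1] at h1
  rw [e2]
  refine le_trans (le_of_eq ?_) h1
  linear_combination eD - t * ec

/-- The chord of `t ↦ t ^ p` over `[m, M]` lies above the power on `[m, M]` and below
`K(M / m, p) t ^ p` on the whole positive half-line. -/
theorem exists_chord {m M p : ℝ} (hm : 0 < m) (hmM : m < M) (hp : 1 < p ∨ p < 0) :
    ∃ α β : ℝ, (1 < p → 0 ≤ α) ∧ (∀ t, m ≤ t → t ≤ M → t ^ p ≤ α * t + β) ∧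
      ∀ t, 0 < t → α * t + β ≤ Kconst (M / m) p * t ^ p := by
  have hh : 1 < M / m := (one_lt_div hm).2 hmM
  set h := M / m with hdef
  have hmp : 0 < m ^ p := Real.rpow_pos_of_pos hm p
  have hh1 : 0 < h - 1 := by linarith
  have key (t : ℝ) : m ^ p * (h ^ p - 1) / ((h - 1) * m) * t + m ^ p * (h - h ^ p) / (h - 1) =
      m ^ p * (((h - t / m) + h ^ p * (t / m - 1)) / (h - 1)) := by
    field_simp
    ring
  have scale {t : ℝ} (ht : 0 < t) : t ^ p = m ^ p * (t / m) ^ p := by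
    rw [← Real.mul_rpow hm.le (div_pos ht hm).le, mul_div_cancel₀ _ hm.ne']
  refine ⟨m ^ p * (h ^ p - 1) / ((h - 1) * m), m ^ p * (h - h ^ p) / (h - 1), ?_, ?_, ?_⟩
  · intro hp
    have : 1 ≤ h ^ p := Real.one_le_rpow hh.le (by linarith)
    exact div_nonneg (mul_nonneg hmp.le (by linarith)) (by positivity)
  · intro t h1 h2
    rw [key, scale (hm.trans_le h1)]
    refine mul_le_mul_of_nonneg_left ?_ hmp.le
    rw [le_div_iff₀ hh1]
    exact rpow_le_chord hh ((one_le_div hm).2 h1) (div_le_div_of_nonneg_right h2 hm.le) hp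
  · intro t ht
    rw [key, scale ht, mul_left_comm]
    refine mul_le_mul_of_nonneg_left ?_ hmp.le
    rw [div_le_iff₀ hh1]
    exact chord_le_Kconst_mul_rpow hh (div_pos ht hm) hp

section CStar

theorem cfc_affine {R : Type*} [CStarAlgebra R] {X : R} (hX : IsSelfAdjoint X) (α β : ℝ) :
    cfc (fun t : ℝ => α * t + β) X = α • X + β • (1 : R) := by
  rw [cfc_add_const β (fun t : ℝ => α * t) X, cfc_const_mul_id α X, Algebra.algebraMap_eq_smul_one]

variable {R : Type*} [CStarAlgebra R] [PartialOrder R] [StarOrderedRing R]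

theorem isStrictlyPositive_of_smul_one_le {X : R} {m : ℝ} (hm : 0 < m) (h : m • (1 : R) ≤ X) :
    IsStrictlyPositive X := by
  refine IsStrictlyPositive.of_le ?_ h
  exact IsStrictlyPositive.smul hm isStrictlyPositive_one

theorem spectrum_pos {X : R} (hX : IsStrictlyPositive X) {t : ℝ} (ht : t ∈ spectrum ℝ X) :
    0 < t := by
  refine lt_of_le_of_ne (spectrum_nonneg_of_nonneg hX.nonneg ht) ?_
  rintro rfl
  exact spectrum.zero_notMem ℝ hX.isUnit ht

theorem continuousOn_rpow_spectrum {X : R} (hX : IsStrictlyPositive X) (p : ℝ) :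
    ContinuousOn (fun t : ℝ => t ^ p) (spectrum ℝ X) :=
  continuousOn_id.rpow_const fun _ ht => Or.inl (spectrum_pos hX ht).ne'

theorem rpow_le_affine {X : R} {m M p α β : ℝ} (hm : 0 < m) (h1 : m • (1 : R) ≤ X)
    (h2 : X ≤ M • (1 : R)) (h : ∀ t, m ≤ t → t ≤ M → t ^ p ≤ α * t + β) :
    X ^ p ≤ α • X + β • (1 : R) := by
  have hX := isStrictlyPositive_of_smul_one_le hm h1
  have hsa : IsSelfAdjoint X := .of_nonneg hX.nonneg
  have hc := continuousOn_rpow_spectrum hX p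
  rw [← Algebra.algebraMap_eq_smul_one] at h1 h2
  rw [← cfc_affine hsa, CFC.rpow_eq_cfc_real hX.nonneg]
  exact cfc_mono fun t ht => h t ((algebraMap_le_iff_le_spectrum (ha := hsa)).1 h1 t ht)
    ((le_algebraMap_iff_spectrum_le (ha := hsa)).1 h2 t ht)

theorem affine_le_smul_rpow {X : R} {p α β K : ℝ} (hX : IsStrictlyPositive X)
    (h : ∀ t, 0 < t → α * t + β ≤ K * t ^ p) :
    α • X + β • (1 : R) ≤ K • X ^ p := by
  have hsa : IsSelfAdjoint X := .of_nonneg hX.nonneg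
  have hc := continuousOn_rpow_spectrum hX p
  rw [← cfc_affine hsa, CFC.rpow_eq_cfc_real hX.nonneg, ← cfc_const_mul K _ X]
  exact cfc_mono fun t ht => h t (spectrum_pos hX ht)

theorem rpow_mem_bounds {X : R} {m M p c d : ℝ} (hm : 0 < m) (h1 : m • (1 : R) ≤ X)
    (h2 : X ≤ M • (1 : R)) (h : ∀ t, m ≤ t → t ≤ M → c ≤ t ^ p ∧ t ^ p ≤ d) :
    c • (1 : R) ≤ X ^ p ∧ X ^ p ≤ d • (1 : R) := by
  have hX := isStrictlyPositive_of_smul_one_le hm h1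
  have hsa : IsSelfAdjoint X := .of_nonneg hX.nonneg
  have hc := continuousOn_rpow_spectrum hX p
  rw [← Algebra.algebraMap_eq_smul_one] at h1 h2
  simp only [← Algebra.algebraMap_eq_smul_one]
  rw [CFC.rpow_eq_cfc_real hX.nonneg]
  have key t (ht : t ∈ spectrum ℝ X) := h t ((algebraMap_le_iff_le_spectrum (ha := hsa)).1 h1 t ht)
    ((le_algebraMap_iff_spectrum_le (ha := hsa)).1 h2 t ht)
  exact ⟨algebraMap_le_cfc _ _ _ fun t ht => (key t ht).1,
    cfc_le_algebraMap _ _ _ fun t ht => (key t ht).2⟩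

theorem rpow_bounds_of_pos {X : R} {m M p : ℝ} (hm : 0 < m) (h1 : m • (1 : R) ≤ X)
    (h2 : X ≤ M • (1 : R)) (hp : 0 < p) :
    m ^ p • (1 : R) ≤ X ^ p ∧ X ^ p ≤ M ^ p • (1 : R) :=
  rpow_mem_bounds hm h1 h2 fun _ ht1 ht2 =>
    ⟨Real.rpow_le_rpow hm.le ht1 hp.le, Real.rpow_le_rpow (hm.le.trans ht1) ht2 hp.le⟩

theorem rpow_bounds_of_neg {X : R} {m M p : ℝ} (hm : 0 < m) (h1 : m • (1 : R) ≤ X)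
    (h2 : X ≤ M • (1 : R)) (hp : p < 0) :
    M ^ p • (1 : R) ≤ X ^ p ∧ X ^ p ≤ m ^ p • (1 : R) :=
  rpow_mem_bounds hm h1 h2 fun _ ht1 ht2 =>
    ⟨Real.rpow_le_rpow_of_nonpos (hm.trans_le ht1) ht2 hp.le,
      Real.rpow_le_rpow_of_nonpos hm ht1 hp.le⟩

theorem smul_cfc_rpow {X : R} (hX : IsStrictlyPositive X) {c : ℝ} (hc : 0 < c) (p : ℝ) :
    (c • X) ^ p = c ^ p • X ^ p := by
  have hsa : IsSelfAdjoint X := .of_nonneg hX.nonneg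
  have h := continuousOn_rpow_spectrum hX p
  rw [CFC.rpow_eq_cfc_real hX.nonneg, ← cfc_const_mul_id c X,
    CFC.cfc_rpow (fun t ht => mul_pos hc (spectrum_pos hX ht)), ← cfc_smul ..]
  exact cfc_congr fun t ht => Real.mul_rpow hc.le (spectrum_pos hX ht).le

/-- Kantorovich-type operator inequality: `X ≤ Y` and `m ≤ X ≤ M` imply
`X ^ p ≤ K(M / m, p) Y ^ p` for `p > 1`. -/
theorem rpow_le_Kconst_smul_rpow {X Y : R} {m M p : ℝ} (hm : 0 < m) (hmM : m < M)
    (h1 : m • (1 : R) ≤ X) (h2 : X ≤ M • (1 : R)) (hXY : X ≤ Y) (hp : 1 < p) :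
    X ^ p ≤ Kconst (M / m) p • Y ^ p := by
  obtain ⟨α, β, hα, hch, hK⟩ := exists_chord hm hmM (Or.inl hp)
  calc X ^ p ≤ α • X + β • (1 : R) := rpow_le_affine hm h1 h2 hch
    _ ≤ α • Y + β • (1 : R) := by
      gcongr
      exact hα hp
    _ ≤ _ := affine_le_smul_rpow (isStrictlyPositive_of_smul_one_le hm (h1.trans hXY)) hK

variable {n : ℕ} {ω : Fin n → ℝ}

theorem sum_smul_bounds (hω0 : ∀ j, 0 ≤ ω j) (hω1 : ∑ j, ω j = 1) {C : Fin n → R} {m M : ℝ}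
    (h1 : ∀ j, m • (1 : R) ≤ C j) (h2 : ∀ j, C j ≤ M • (1 : R)) :
    m • (1 : R) ≤ ∑ j, ω j • C j ∧ ∑ j, ω j • C j ≤ M • (1 : R) := by
  have e (x : ℝ) : x • (1 : R) = ∑ j, ω j • (x • (1 : R)) := by
    rw [← Finset.sum_smul, hω1, one_smul]
  rw [e m, e M]
  exact ⟨Finset.sum_le_sum fun j _ => smul_le_smul_of_nonneg_left (h1 j) (hω0 j),
    Finset.sum_le_sum fun j _ => smul_le_smul_of_nonneg_left (h2 j) (hω0 j)⟩

/-- Converse of Jensen's operator inequality for negative powers. -/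
theorem sum_smul_rpow_le (hω0 : ∀ j, 0 ≤ ω j) (hω1 : ∑ j, ω j = 1) {C : Fin n → R} {m M p : ℝ}
    (hm : 0 < m) (hmM : m < M) (h1 : ∀ j, m • (1 : R) ≤ C j) (h2 : ∀ j, C j ≤ M • (1 : R))
    (hp : p < 0) :
    ∑ j, ω j • C j ^ p ≤ Kconst (M / m) p • (∑ j, ω j • C j) ^ p := by
  obtain ⟨α, β, -, hch, hK⟩ := exists_chord hm hmM (Or.inr hp)
  calc ∑ j, ω j • C j ^ p ≤ ∑ j, ω j • (α • C j + β • (1 : R)) :=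
        Finset.sum_le_sum fun j _ =>
          smul_le_smul_of_nonneg_left (rpow_le_affine hm (h1 j) (h2 j) hch) (hω0 j)
    _ = α • (∑ j, ω j • C j) + β • (1 : R) := by
      simp only [smul_add, Finset.sum_add_distrib, ← Finset.sum_smul, hω1, one_smul,
        Finset.smul_sum, smul_comm α]
    _ ≤ _ := affine_le_smul_rpow (isStrictlyPositive_of_smul_one_le hm
        (sum_smul_bounds hω0 hω1 h1 h2).1) hK

end CStar

section Sandwich

variable {E : Type*} [NormedAddCommGroup E] [InnerProductSpace ℂ E] [CompleteSpace E] {n : ℕ}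
  {ω : Fin n → ℝ} {F : (Fin n → (E →L[ℂ] E)) → (E →L[ℂ] E)}

theorem inverse_smul_one {R : Type*} [CStarAlgebra R] [PartialOrder R] [StarOrderedRing R]
    {c : ℝ} (hc : 0 < c) : Ring.inverse (c • (1 : R)) = c⁻¹ • (1 : R) := by
  rw [CFC.inverse_eq_rpow_neg_one (IsStrictlyPositive.smul hc isStrictlyPositive_one),
    smul_cfc_rpow isStrictlyPositive_one hc, CFC.one_rpow, Real.rpow_neg_one]

theorem inverse_bounds {R : Type*} [CStarAlgebra R] [PartialOrder R] [StarOrderedRing R]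
    {X : R} {m M : ℝ} (hm : 0 < m) (hM : 0 < M) (h1 : m • (1 : R) ≤ X) (h2 : X ≤ M • (1 : R)) :
    M⁻¹ • (1 : R) ≤ Ring.inverse X ∧ Ring.inverse X ≤ m⁻¹ • (1 : R) := by
  rw [← inverse_smul_one hm, ← inverse_smul_one hM]
  exact ⟨CStarAlgebra.ringInverse_le_ringInverse h2 (isStrictlyPositive_of_smul_one_le hm h1),
    CStarAlgebra.ringInverse_le_ringInverse h1 (IsStrictlyPositive.smul hm isStrictlyPositive_one)⟩

theorem IsAHSandwich.bounds (hF : IsAHSandwich ω F) (hω0 : ∀ j, 0 ≤ ω j) (hω1 : ∑ j, ω j = 1)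
    {B : Fin n → (E →L[ℂ] E)} {m M : ℝ} (hm : 0 < m) (hM : 0 < M)
    (h1 : ∀ j, m • (1 : E →L[ℂ] E) ≤ B j) (h2 : ∀ j, B j ≤ M • (1 : E →L[ℂ] E)) :
    m • (1 : E →L[ℂ] E) ≤ F B ∧ F B ≤ M • (1 : E →L[ℂ] E) := by
  have hB j := isStrictlyPositive_of_smul_one_le hm (h1 j)
  obtain ⟨-, hl, hu⟩ := hF B (fun j => (hB j).nonneg) fun j => (hB j).isUnit
  have h3 j := inverse_bounds hm hM (h1 j) (h2 j)
  obtain ⟨h4, h5⟩ := sum_smul_bounds hω0 hω1 (fun j => (h3 j).1) (fun j => (h3 j).2)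
  have h6 := (inverse_bounds (inv_pos.2 hM) (inv_pos.2 hm) h4 h5).1
  rw [inv_inv] at h6
  exact ⟨h6.trans hl, hu.trans (sum_smul_bounds hω0 hω1 h1 h2).2⟩

/-- Both power comparisons `F(A ^ q) ≤ K F(A ^ p) ^ (q / p)` and
`F(A ^ p) ^ (q / p) ≤ K F(A ^ q)` with `K = K((M / m) ^ p, -q / p)`. -/
theorem IsAHSandwich.rpow_comparison (hF : IsAHSandwich ω F) (hω0 : ∀ j, 0 ≤ ω j)
    (hω1 : ∑ j, ω j = 1) {m M : ℝ} (hm : 0 < m) (hmM : m < M) {A : Fin n → (E →L[ℂ] E)}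
    (hA1 : ∀ j, m • (1 : E →L[ℂ] E) ≤ A j) (hA2 : ∀ j, A j ≤ M • (1 : E →L[ℂ] E))
    {p q : ℝ} (hq0 : 0 < q) (hqp : q < p) :
    F (fun j => A j ^ q) ≤
        Kconst ((M / m) ^ p) (-(q / p)) • F (fun j => A j ^ p) ^ (q / p) ∧
      F (fun j => A j ^ p) ^ (q / p) ≤
        Kconst ((M / m) ^ p) (-(q / p)) • F (fun j => A j ^ q) := by
  have hp0 : 0 < p := hq0.trans hqp
  have hM : 0 < M := hm.trans hmM
  have hr0 : 0 < q / p := div_pos hq0 hp0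
  have hr : q / p ∈ Set.Icc (0 : ℝ) 1 := ⟨hr0.le, (div_le_one hp0).2 hqp.le⟩
  have hA j := isStrictlyPositive_of_smul_one_le hm (hA1 j)
  have hK : 0 < Kconst ((M / m) ^ p) (-(q / p)) :=
    Kconst_pos (Real.one_lt_rpow ((one_lt_div hm).2 hmM) hp0) (Or.inr (neg_neg_of_pos hr0))
  obtain ⟨-, hlp, hup⟩ := hF (fun j => A j ^ p) (fun j => CFC.rpow_nonneg)
    fun j => ((hA j).rpow (A j) p).isUnit
  obtain ⟨-, hlq, huq⟩ := hF (fun j => A j ^ q) (fun j => CFC.rpow_nonneg)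
    fun j => ((hA j).rpow (A j) q).isUnit
  simp only [CFC.inverse_rpow _ _ hp0.ne' (hA _)] at hlp
  simp only [CFC.inverse_rpow _ _ hq0.ne' (hA _)] at hlq
  have bp j := rpow_bounds_of_pos hm (hA1 j) (hA2 j) hp0
  have bn j := rpow_bounds_of_neg hm (hA1 j) (hA2 j) (neg_neg_of_pos hp0)
  have hmp := Real.rpow_pos_of_pos hm p
  have hMn := Real.rpow_pos_of_pos hM (-p)
  constructor
  · have hS := isStrictlyPositive_of_smul_one_le hMn
      (sum_smul_bounds hω0 hω1 (fun j => (bn j).1) fun j => (bn j).2).1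
    have h1 := sum_smul_rpow_le hω0 hω1 hMn
      (Real.rpow_lt_rpow_of_neg hm hmM (neg_neg_of_pos hp0))
      (fun j => (bn j).1) (fun j => (bn j).2) (neg_neg_of_pos hr0)
    have e1 : m ^ (-p) / M ^ (-p) = (M / m) ^ p := by
      rw [Real.rpow_neg hm.le, Real.rpow_neg hM.le, inv_div_inv, Real.div_rpow hM.le hm.le]
    have e2 j : (A j ^ (-p)) ^ (-(q / p)) = A j ^ q := by
      rw [CFC.rpow_rpow _ _ _ (neg_ne_zero.2 hp0.ne') (hA j)]
      congr 1
      field_simp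
    simp only [e1, e2] at h1
    have h2 := CFC.rpow_le_rpow hr hlp
    rw [CFC.inverse_eq_rpow_neg_one hS, CFC.rpow_rpow _ _ _ (by norm_num) hS, neg_one_mul] at h2
    exact huq.trans (h1.trans (smul_le_smul_of_nonneg_left h2 hK.le))
  · have hT := isStrictlyPositive_of_smul_one_le hmp
      (sum_smul_bounds hω0 hω1 (fun j => (bp j).1) fun j => (bp j).2).1
    have h1 := sum_smul_rpow_le hω0 hω1 hmp (Real.rpow_lt_rpow hm.le hmM hp0)
      (fun j => (bp j).1) (fun j => (bp j).2) (neg_neg_of_pos hr0)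
    have e2 j : (A j ^ p) ^ (-(q / p)) = A j ^ (-q) := by
      rw [CFC.rpow_rpow _ _ _ hp0.ne' (hA j)]
      congr 1
      field_simp
    simp only [← Real.div_rpow hM.le hm.le, e2] at h1
    have bq j := rpow_bounds_of_neg hm (hA1 j) (hA2 j) (neg_neg_of_pos hq0)
    have hS := isStrictlyPositive_of_smul_one_le (Real.rpow_pos_of_pos hM (-q))
      (sum_smul_bounds hω0 hω1 (fun j => (bq j).1) fun j => (bq j).2).1
    have h2 := CStarAlgebra.ringInverse_le_ringInverse h1 hS
    rw [CFC.inverse_eq_rpow_neg_one (IsStrictlyPositive.smul hK (hT.rpow _ _)),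
      smul_cfc_rpow (hT.rpow _ _) hK, CFC.rpow_rpow _ _ _ (neg_ne_zero.2 hr0.ne') hT,
      Real.rpow_neg_one, mul_neg_one, neg_neg] at h2
    have h3 := smul_le_smul_of_nonneg_left (h2.trans hlq) hK.le
    rw [smul_inv_smul₀ hK.ne'] at h3
    exact (CFC.rpow_le_rpow hr hup).trans h3

end Sandwich

theorem stmt18
    {H : Type*}
    [NormedAddCommGroup H] [InnerProductSpace ℂ H] [CompleteSpace H]
    {n : ℕ} (ω : Fin n → ℝ) (hω0 : ∀ j, 0 ≤ ω j) (hω1 : ∑ j, ω j = 1)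
    (m M : ℝ) (hm : 0 < m) (hmM : m < M)
    (A : Fin n → (H →L[ℂ] H))
    (hA0 : ∀ j, 0 ≤ A j) (hAu : ∀ j, IsUnit (A j))
    (hA1 : ∀ j, m • (1 : H →L[ℂ] H) ≤ A j)
    (hA2 : ∀ j, A j ≤ M • (1 : H →L[ℂ] H))
    (F : (Fin n → (H →L[ℂ] H)) → (H →L[ℂ] H))
    (hF : IsAHSandwich ω F)
    (p q : ℝ) (hq0 : 0 < q) (hq1 : q < 1) (hqp : q < p)
    :
    ((Kconst ((M / m) ^ q) (1 / q))⁻¹ * (Kconst ((M / m) ^ p) (-(q / p))) ^ (-(1 / q))) •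
        CFC.rpow (F (fun j => CFC.rpow (A j) p)) (1 / p) ≤
      CFC.rpow (F (fun j => CFC.rpow (A j) q)) (1 / q) ∧
    CFC.rpow (F (fun j => CFC.rpow (A j) q)) (1 / q) ≤
      (Kconst ((M / m) ^ q) (1 / q) * (Kconst ((M / m) ^ p) (-(q / p))) ^ (1 / q)) •
        CFC.rpow (F (fun j => CFC.rpow (A j) p)) (1 / p) := by
  simp only [CFC.rpow_eq_pow]
  have hp0 : 0 < p := hq0.trans hqp
  have hM : 0 < M := hm.trans hmM
  have hh : 1 < M / m := (one_lt_div hm).2 hmM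
  have hs : 1 < 1 / q := (one_lt_div hq0).2 hq1
  have hK1 : 0 < Kconst ((M / m) ^ p) (-(q / p)) :=
    Kconst_pos (Real.one_lt_rpow hh hp0) (Or.inr (neg_neg_of_pos (div_pos hq0 hp0)))
  have hK2 : 0 < Kconst ((M / m) ^ q) (1 / q) :=
    Kconst_pos (Real.one_lt_rpow hh hq0) (Or.inl hs)
  obtain ⟨h1, h2⟩ := hF.rpow_comparison hω0 hω1 hm hmM hA1 hA2 hq0 hqp
  have hmp := Real.rpow_pos_of_pos hm p
  have hmq := Real.rpow_pos_of_pos hm q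
  have bU := hF.bounds hω0 hω1 hmp (Real.rpow_pos_of_pos hM p)
    (fun j => (rpow_bounds_of_pos hm (hA1 j) (hA2 j) hp0).1)
    fun j => (rpow_bounds_of_pos hm (hA1 j) (hA2 j) hp0).2
  have bV := hF.bounds hω0 hω1 hmq (Real.rpow_pos_of_pos hM q)
    (fun j => (rpow_bounds_of_pos hm (hA1 j) (hA2 j) hq0).1)
    fun j => (rpow_bounds_of_pos hm (hA1 j) (hA2 j) hq0).2
  have hU := isStrictlyPositive_of_smul_one_le hmp bU.1
  have hV := isStrictlyPositive_of_smul_one_le hmq bV.1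
  have hmMq := Real.rpow_lt_rpow hm.le hmM hq0
  have bUr := rpow_bounds_of_pos hmp bU.1 bU.2 (div_pos hq0 hp0)
  rw [← Real.rpow_mul hm.le, ← Real.rpow_mul hM.le, mul_div_cancel₀ _ hp0.ne'] at bUr
  have e : q / p * (1 / q) = 1 / p := by field_simp
  have h3 := rpow_le_Kconst_smul_rpow hmq hmMq bV.1 bV.2 h1 hs
  have h4 := rpow_le_Kconst_smul_rpow hmq hmMq bUr.1 bUr.2 h2 hs
  rw [smul_cfc_rpow (hU.rpow _ _) hK1, CFC.rpow_rpow _ _ _ (div_pos hq0 hp0).ne' hU, e,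
    ← Real.div_rpow hM.le hm.le, smul_smul] at h3
  rw [smul_cfc_rpow hV hK1, CFC.rpow_rpow _ _ _ (div_pos hq0 hp0).ne' hU, e,
    ← Real.div_rpow hM.le hm.le, smul_smul] at h4
  refine ⟨?_, h3⟩
  rw [Real.rpow_neg hK1.le, ← mul_inv]
  have hK := mul_pos hK2 (Real.rpow_pos_of_pos hK1 (1 / q))
  have h5 := smul_le_smul_of_nonneg_left h4 (inv_pos.2 hK).le
  rwa [inv_smul_smul₀ hK.ne'] at h5
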